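/- arXiv:1801.00443 — 8 statements merged into one kernel-verified Lean document; each statement's English description precedes it below -/
import Mathlib

section
/- Let (x, p1, p2) be a feasible trajectory and power allocation and let (r1, r2) be achievable for (x, p1, p2). Define the clamped trajectory x̂(t) = max(-D/2, min(D/2, x(t))). Then x̂ is V-Lipschitz with x̂(t) ∈ [-D/2, D/2] for all t, h1(x̂(t)) ≥ h1(x(t)) and h2(x̂(t)) ≥ h2(x(t)) for all t, and (r1, r2) is achievable for (x̂, p1, p2). Consequently, every point of C(V,T,P̄) is achievable by a trajectory staying above the line segment between the two users, i.e., with values in [-D/2, D/2]. -/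
open MeasureTheory

/-- Channel power gain (normalized by noise) from the UAV at horizontal position `x`
to ground user 1 located at `-D/2`. -/
noncomputable def h1 (D H β0 x : ℝ) : ℝ := β0 / ((x + D / 2) ^ 2 + H ^ 2)

/-- Channel power gain from the UAV at horizontal position `x` to ground user 2
located at `D/2`. -/
noncomputable def h2 (D H β0 x : ℝ) : ℝ := β0 / ((x - D / 2) ^ 2 + H ^ 2)

/-- A feasible trajectory is a `V`-Lipschitz function on `[0, T]`. -/
def FeasibleTraj (V T : ℝ) (x : ℝ → ℝ) : Prop :=
  ∀ s ∈ Set.Icc (0 : ℝ) T, ∀ t ∈ Set.Icc (0 : ℝ) T, |x s - x t| ≤ V * |s - t|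

/-- A feasible power allocation: measurable, nonnegative, total power at most `P`. -/
def FeasiblePower (P T : ℝ) (p1 p2 : ℝ → ℝ) : Prop :=
  Measurable p1 ∧ Measurable p2 ∧
    ∀ t ∈ Set.Icc (0 : ℝ) T, 0 ≤ p1 t ∧ 0 ≤ p2 t ∧ p1 t + p2 t ≤ P

/-- The rate pair `(r1, r2)` is achievable for trajectory `x` and power allocation
`(p1, p2)`. -/
def Achievable (D H β0 T : ℝ) (x p1 p2 : ℝ → ℝ) (r1 r2 : ℝ) : Prop :=
  0 ≤ r1 ∧ 0 ≤ r2 ∧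
    r1 ≤ (1 / T) * ∫ t in (0 : ℝ)..T, Real.logb 2 (1 + p1 t * h1 D H β0 (x t)) ∧
    r2 ≤ (1 / T) * ∫ t in (0 : ℝ)..T, Real.logb 2 (1 + p2 t * h2 D H β0 (x t)) ∧
    r1 + r2 ≤ (1 / T) * ∫ t in (0 : ℝ)..T,
      Real.logb 2 (1 + p1 t * h1 D H β0 (x t) + p2 t * h2 D H β0 (x t))

/-- The capacity region `C(V, T, P)` of the UAV-enabled two-user broadcast channel. -/
def CapacityRegion (D H β0 P V T : ℝ) : Set (ℝ × ℝ) :=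
  {r | ∃ x p1 p2, FeasibleTraj V T x ∧ FeasiblePower P T p1 p2 ∧
    Achievable D H β0 T x p1 p2 r.1 r.2}

/-- The trajectory clamped to the segment `[-D/2, D/2]` above the two users. -/
noncomputable def clampTraj (D : ℝ) (x : ℝ → ℝ) : ℝ → ℝ :=
  fun t => max (-(D / 2)) (min (D / 2) (x t))

/-- A measurable, nonnegative, bounded signal-to-noise ratio has an integrable rate. -/
lemma intervalIntegrable_logb_one_add {T C : ℝ} (hT : 0 ≤ T) {f : ℝ → ℝ}
    (hf : AEMeasurable f (volume.restrict (Set.Ioc 0 T)))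
    (h0 : ∀ t ∈ Set.Icc (0 : ℝ) T, 0 ≤ f t) (hC : ∀ t ∈ Set.Icc (0 : ℝ) T, f t ≤ C) :
    IntervalIntegrable (fun t => Real.logb 2 (1 + f t)) volume 0 T := by
  rw [intervalIntegrable_iff_integrableOn_Ioc_of_le hT]
  refine Integrable.of_bound ?_ (Real.logb 2 (1 + C)) ?_
  · exact ((Real.measurable_log.comp_aemeasurable (hf.const_add 1)).div_const
      (Real.log 2)).aestronglyMeasurable
  · refine (ae_restrict_iff' measurableSet_Ioc).2 (ae_of_all _ fun t ht => ?_)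
    have h0t := h0 t (Set.Ioc_subset_Icc_self ht)
    have hCt := hC t (Set.Ioc_subset_Icc_self ht)
    rw [Real.norm_of_nonneg (Real.logb_nonneg one_lt_two (by linarith))]
    exact Real.logb_le_logb_of_le one_lt_two (by linarith) (by linarith)

/-- The average rate is monotone in the signal-to-noise ratio. -/
lemma average_logb_one_add_mono {T C : ℝ} (hT : 0 ≤ T) {f g : ℝ → ℝ}
    (hf : AEMeasurable f (volume.restrict (Set.Ioc 0 T)))
    (hg : AEMeasurable g (volume.restrict (Set.Ioc 0 T)))
    (h0 : ∀ t ∈ Set.Icc (0 : ℝ) T, 0 ≤ f t) (hfg : ∀ t ∈ Set.Icc (0 : ℝ) T, f t ≤ g t)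
    (hC : ∀ t ∈ Set.Icc (0 : ℝ) T, g t ≤ C) :
    (1 / T) * ∫ t in (0 : ℝ)..T, Real.logb 2 (1 + f t) ≤
      (1 / T) * ∫ t in (0 : ℝ)..T, Real.logb 2 (1 + g t) := by
  refine mul_le_mul_of_nonneg_left ?_ (by positivity)
  refine intervalIntegral.integral_mono_on hT
    (intervalIntegrable_logb_one_add hT hf h0 fun t ht => (hfg t ht).trans (hC t ht))
    (intervalIntegrable_logb_one_add hT hg (fun t ht => (h0 t ht).trans (hfg t ht)) hC)
    fun t ht => ?_
  have h0t := h0 t ht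
  exact Real.logb_le_logb_of_le one_lt_two (by linarith) (by linarith [hfg t ht])

lemma FeasibleTraj.continuousOn {V T : ℝ} {x : ℝ → ℝ} (hV : 0 ≤ V) (hx : FeasibleTraj V T x) :
    ContinuousOn x (Set.Icc 0 T) := by
  refine (LipschitzOnWith.of_dist_le_mul (K := ⟨V, hV⟩) fun s hs t ht => ?_).continuousOn
  exact hx s hs t ht

lemma FeasibleTraj.clampTraj {V T : ℝ} {x : ℝ → ℝ} (D : ℝ) (hx : FeasibleTraj V T x) :
    FeasibleTraj V T (clampTraj D x) := by
  intro s hs t ht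
  refine le_trans ?_ (hx s hs t ht)
  refine (abs_max_sub_max_le_max _ _ _ _).trans ?_
  rw [sub_self, abs_zero, max_eq_right (abs_nonneg _)]
  refine (abs_min_sub_min_le_max _ _ _ _).trans ?_
  rw [sub_self, abs_zero, max_eq_right (abs_nonneg _)]

lemma clampTraj_mem_Icc {D : ℝ} (hD : 0 ≤ D) (x : ℝ → ℝ) (t : ℝ) :
    clampTraj D x t ∈ Set.Icc (-(D / 2)) (D / 2) :=
  ⟨le_max_left _ _, max_le (by linarith) (min_le_left _ _)⟩

/-- Clamping a trajectory to an interval brings it closer to each point of the interval. -/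
lemma sq_clampTraj_sub_le {D a : ℝ} (ha : a ∈ Set.Icc (-(D / 2)) (D / 2)) (x : ℝ → ℝ) (t : ℝ) :
    (clampTraj D x t - a) ^ 2 ≤ (x t - a) ^ 2 := by
  rw [sq_le_sq]
  have hc : max (-(D / 2)) (min (D / 2) a) = a := by
    rw [min_eq_right ha.2, max_eq_right ha.1]
  calc |clampTraj D x t - a|
      = |max (-(D / 2)) (min (D / 2) (x t)) - max (-(D / 2)) (min (D / 2) a)| := by
        rw [hc, clampTraj]
    _ ≤ |min (D / 2) (x t) - min (D / 2) a| := by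
        simpa using abs_max_sub_max_le_max (-(D / 2)) (min (D / 2) (x t)) (-(D / 2)) (min (D / 2) a)
    _ ≤ |x t - a| := by
        simpa using abs_min_sub_min_le_max (D / 2) (x t) (D / 2) a

lemma h1_le_h1_clampTraj {D H β0 : ℝ} (hD : 0 ≤ D) (hH : 0 < H) (hβ : 0 ≤ β0)
    (x : ℝ → ℝ) (t : ℝ) : h1 D H β0 (x t) ≤ h1 D H β0 (clampTraj D x t) := by
  have h := sq_clampTraj_sub_le (D := D) (a := -(D / 2)) ⟨le_rfl, by linarith⟩ x t
  rw [sub_neg_eq_add, sub_neg_eq_add] at h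
  unfold h1
  gcongr

lemma h2_le_h2_clampTraj {D H β0 : ℝ} (hD : 0 ≤ D) (hH : 0 < H) (hβ : 0 ≤ β0)
    (x : ℝ → ℝ) (t : ℝ) : h2 D H β0 (x t) ≤ h2 D H β0 (clampTraj D x t) := by
  have h := sq_clampTraj_sub_le (D := D) (a := D / 2) ⟨by linarith, le_rfl⟩ x t
  unfold h2
  gcongr

lemma h1_nonneg {β0 : ℝ} (hβ : 0 ≤ β0) (D H x : ℝ) : 0 ≤ h1 D H β0 x := by
  unfold h1; positivity

lemma h2_nonneg {β0 : ℝ} (hβ : 0 ≤ β0) (D H x : ℝ) : 0 ≤ h2 D H β0 x := by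
  unfold h2; positivity

lemma h1_le {H β0 : ℝ} (hH : 0 < H) (hβ : 0 ≤ β0) (D x : ℝ) : h1 D H β0 x ≤ β0 / H ^ 2 := by
  unfold h1
  gcongr
  exact le_add_of_nonneg_left (sq_nonneg _)

lemma h2_le {H β0 : ℝ} (hH : 0 < H) (hβ : 0 ≤ β0) (D x : ℝ) : h2 D H β0 x ≤ β0 / H ^ 2 := by
  unfold h2
  gcongr
  exact le_add_of_nonneg_left (sq_nonneg _)

lemma measurable_h1 (D H β0 : ℝ) : Measurable (h1 D H β0) := by
  unfold h1; fun_prop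

lemma measurable_h2 (D H β0 : ℝ) : Measurable (h2 D H β0) := by
  unfold h2; fun_prop

/-- Achievability passes to the clamped trajectory. -/
lemma Achievable.clampTraj {D H β0 P V T : ℝ} (hD : 0 ≤ D) (hH : 0 < H) (hβ : 0 ≤ β0)
    (hV : 0 ≤ V) (hT : 0 ≤ T) {x p1 p2 : ℝ → ℝ} {r1 r2 : ℝ}
    (hx : FeasibleTraj V T x) (hp : FeasiblePower P T p1 p2)
    (hach : Achievable D H β0 T x p1 p2 r1 r2) :
    Achievable D H β0 T (clampTraj D x) p1 p2 r1 r2 := by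
  obtain ⟨hr1, hr2, hb1, hb2, hb⟩ := hach
  obtain ⟨hm1, hm2, hp⟩ := hp
  have aemeas {y : ℝ → ℝ} (hy : FeasibleTraj V T y) :
      AEMeasurable y (volume.restrict (Set.Ioc 0 T)) :=
    ((hy.continuousOn hV).mono Set.Ioc_subset_Icc_self).aemeasurable measurableSet_Ioc
  have meas1 {y : ℝ → ℝ} (hy : FeasibleTraj V T y) :
      AEMeasurable (fun t => p1 t * h1 D H β0 (y t)) (volume.restrict (Set.Ioc 0 T)) :=
    hm1.aemeasurable.mul ((measurable_h1 D H β0).comp_aemeasurable (aemeas hy))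
  have meas2 {y : ℝ → ℝ} (hy : FeasibleTraj V T y) :
      AEMeasurable (fun t => p2 t * h2 D H β0 (y t)) (volume.restrict (Set.Ioc 0 T)) :=
    hm2.aemeasurable.mul ((measurable_h2 D H β0).comp_aemeasurable (aemeas hy))
  have hx' := hx.clampTraj D
  have nonneg1 : ∀ t ∈ Set.Icc (0 : ℝ) T, 0 ≤ p1 t * h1 D H β0 (x t) := fun t ht =>
    mul_nonneg (hp t ht).1 (h1_nonneg hβ _ _ _)
  have nonneg2 : ∀ t ∈ Set.Icc (0 : ℝ) T, 0 ≤ p2 t * h2 D H β0 (x t) := fun t ht =>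
    mul_nonneg (hp t ht).2.1 (h2_nonneg hβ _ _ _)
  have mono1 : ∀ t ∈ Set.Icc (0 : ℝ) T,
      p1 t * h1 D H β0 (x t) ≤ p1 t * h1 D H β0 (_root_.clampTraj D x t) := fun t ht =>
    mul_le_mul_of_nonneg_left (h1_le_h1_clampTraj hD hH hβ x t) (hp t ht).1
  have mono2 : ∀ t ∈ Set.Icc (0 : ℝ) T,
      p2 t * h2 D H β0 (x t) ≤ p2 t * h2 D H β0 (_root_.clampTraj D x t) := fun t ht =>
    mul_le_mul_of_nonneg_left (h2_le_h2_clampTraj hD hH hβ x t) (hp t ht).2.1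
  have bound1 : ∀ t ∈ Set.Icc (0 : ℝ) T,
      p1 t * h1 D H β0 (_root_.clampTraj D x t) ≤ P * (β0 / H ^ 2) := fun t ht => by
    obtain ⟨h₁, h₂, h₃⟩ := hp t ht
    exact mul_le_mul (by linarith) (h1_le hH hβ _ _) (h1_nonneg hβ _ _ _) (by linarith)
  have bound2 : ∀ t ∈ Set.Icc (0 : ℝ) T,
      p2 t * h2 D H β0 (_root_.clampTraj D x t) ≤ P * (β0 / H ^ 2) := fun t ht => by
    obtain ⟨h₁, h₂, h₃⟩ := hp t ht
    exact mul_le_mul (by linarith) (h2_le hH hβ _ _) (h2_nonneg hβ _ _ _) (by linarith)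
  refine ⟨hr1, hr2,
    hb1.trans (average_logb_one_add_mono hT (meas1 hx) (meas1 hx') nonneg1 mono1 bound1),
    hb2.trans (average_logb_one_add_mono hT (meas2 hx) (meas2 hx') nonneg2 mono2 bound2), ?_⟩
  simp only [add_assoc] at hb ⊢
  exact hb.trans (average_logb_one_add_mono hT ((meas1 hx).add (meas2 hx))
    ((meas1 hx').add (meas2 hx')) (fun t ht => add_nonneg (nonneg1 t ht) (nonneg2 t ht))
    (fun t ht => add_le_add (mono1 t ht) (mono2 t ht))
    (fun t ht => add_le_add (bound1 t ht) (bound2 t ht)))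

/-- Clamping a feasible trajectory to `[-D/2, D/2]` keeps it
`V`-Lipschitz, never decreases either channel gain, and preserves achievability;
consequently every point of the capacity region is achievable by a trajectory with
values in `[-D/2, D/2]`. -/
theorem clamped_trajectory_optimal (D H β0 P V T : ℝ)
    (hD : 0 < D) (hH : 0 < H) (hβ : 0 < β0) (hP : 0 < P) (hV : 0 ≤ V) (hT : 0 < T)
    (x p1 p2 : ℝ → ℝ) (r1 r2 : ℝ)
    (hx : FeasibleTraj V T x) (hp : FeasiblePower P T p1 p2)
    (hach : Achievable D H β0 T x p1 p2 r1 r2) :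
    FeasibleTraj V T (clampTraj D x) ∧
    (∀ t ∈ Set.Icc (0 : ℝ) T, clampTraj D x t ∈ Set.Icc (-(D / 2)) (D / 2)) ∧
    (∀ t ∈ Set.Icc (0 : ℝ) T, h1 D H β0 (x t) ≤ h1 D H β0 (clampTraj D x t)) ∧
    (∀ t ∈ Set.Icc (0 : ℝ) T, h2 D H β0 (x t) ≤ h2 D H β0 (clampTraj D x t)) ∧
    Achievable D H β0 T (clampTraj D x) p1 p2 r1 r2 ∧
    (∀ r ∈ CapacityRegion D H β0 P V T, ∃ y q1 q2,
      FeasibleTraj V T y ∧ FeasiblePower P T q1 q2 ∧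
      (∀ t ∈ Set.Icc (0 : ℝ) T, y t ∈ Set.Icc (-(D / 2)) (D / 2)) ∧
      Achievable D H β0 T y q1 q2 r.1 r.2) := by
  refine ⟨hx.clampTraj D, fun t _ => clampTraj_mem_Icc hD.le x t,
    fun t _ => h1_le_h1_clampTraj hD.le hH hβ.le x t,
    fun t _ => h2_le_h2_clampTraj hD.le hH hβ.le x t,
    hach.clampTraj hD.le hH hβ.le hV hT.le hx hp, ?_⟩
  rintro r ⟨y, q1, q2, hy, hq, hr⟩
  exact ⟨clampTraj D y, q1, q2, hy.clampTraj D, hq, fun t _ => clampTraj_mem_Icc hD.le y t,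
    hr.clampTraj hD.le hH hβ.le hV hT.le hy hq⟩
end

section
/- For every (r1, r2) ∈ C(V,T,P̄) there exist a nondecreasing V-Lipschitz trajectory x̂ : [0,T] → ℝ and a feasible power allocation (p̂1, p̂2) such that (r1, r2) is achievable for (x̂, p̂1, p̂2). That is, there always exists a unidirectional optimal UAV trajectory. -/
open MeasureTheory

theorem LipschitzOnWith.comp_projIcc {K : NNReal} {a b : ℝ} (hab : a ≤ b) {f : ℝ → ℝ}
    (hf : LipschitzOnWith K f (Set.Icc a b)) :
    LipschitzWith K fun t ↦ f (Set.projIcc a b hab t) := by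
  have h := hf.to_restrict.comp (LipschitzWith.projIcc hab)
  rw [mul_one] at h
  exact h

open Set Filter Topology in
/-- The nondecreasing rearrangement of a Lipschitz function on a compact interval is Lipschitz with
the same constant and has the same distribution. -/
theorem exists_monotone_lipschitz_rearrangement {K : NNReal} {T : ℝ} (hT : 0 ≤ T) {y : ℝ → ℝ}
    (hy : LipschitzWith K y) :
    ∃ z : ℝ → ℝ, Monotone z ∧ LipschitzWith K z ∧
      (volume.restrict (Icc 0 T)).map z = (volume.restrict (Icc 0 T)).map y := by
  have hne : (Icc (0 : ℝ) T).Nonempty := nonempty_Icc.2 hT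
  obtain ⟨a, ha, hmin⟩ := isCompact_Icc.exists_isMinOn hne hy.continuous.continuousOn
  obtain ⟨b, hb, hmax⟩ := isCompact_Icc.exists_isMaxOn hne hy.continuous.continuousOn
  set ν := (volume.restrict (Icc (0 : ℝ) T)).map y with hν
  have hνfin : IsFiniteMeasure ν := by rw [hν]; infer_instance
  have hνs : ∀ s : Set ℝ, MeasurableSet s → ν s = volume (y ⁻¹' s ∩ Icc 0 T) := fun s hs ↦ by
    rw [hν, Measure.map_apply hy.continuous.measurable hs,
      Measure.restrict_apply (hy.continuous.measurable hs)]
  have hFT : ∀ c, ν.real (Iic c) ≤ T := fun c ↦ by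
    refine ENNReal.toReal_le_of_le_ofReal hT ?_
    rw [hνs _ measurableSet_Iic]
    exact (measure_mono inter_subset_right).trans (by simp)
  have hFb : ν.real (Iic (y b)) = T := by
    rw [Measure.real, hνs _ measurableSet_Iic,
      inter_eq_right.2 (show Icc 0 T ⊆ y ⁻¹' Iic (y b) from fun t ht ↦ hmax ht)]
    simp [hT]
  have hFmono : Monotone fun c ↦ ν.real (Iic c) := fun c d hcd ↦
    measureReal_mono (Iic_subset_Iic.2 hcd)
  have hFright : ∀ c, Tendsto (fun d ↦ ν.real (Iic d)) (𝓝[>] c) (𝓝 (ν.real (Iic c))) := by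
    intro c
    have h := tendsto_measure_biInter_gt (μ := ν) (s := fun d : ℝ ↦ Iic d) (a := c)
      (fun r _ ↦ measurableSet_Iic.nullMeasurableSet) (fun i j _ hij ↦ Iic_subset_Iic.2 hij)
      ⟨c + 1, by simp, measure_ne_top _ _⟩
    have hI : ⋂ r > c, Iic r = Iic c := by
      ext u
      simpa using ⟨fun h ↦ le_of_forall_gt_imp_ge_of_dense h, fun h r hr ↦ h.trans hr.le⟩
    rw [hI] at h
    exact (ENNReal.tendsto_toReal (measure_ne_top _ _)).comp h
  set S : ℝ → Set ℝ := fun t ↦ {c | y a ≤ c ∧ t ≤ ν.real (Iic c)} with hS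
  have hSbdd : ∀ t, BddBelow (S t) := fun t ↦ ⟨y a, fun c hc ↦ hc.1⟩
  have hSne : ∀ t ≤ T, (S t).Nonempty := fun t ht ↦ ⟨y b, hmin hb, ht.trans hFb.ge⟩
  set q : ℝ → ℝ := fun t ↦ sInf (S t) with hq
  have hqa : ∀ t ≤ T, y a ≤ q t := fun t ht ↦ le_csInf (hSne t ht) fun c hc ↦ hc.1
  have hqle : ∀ t ≤ T, ∀ c, y a ≤ c → (q t ≤ c ↔ t ≤ ν.real (Iic c)) := by
    intro t ht c hc
    refine ⟨fun h ↦ ge_of_tendsto (hFright c) ?_, fun h ↦ csInf_le (hSbdd t) ⟨hc, h⟩⟩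
    filter_upwards [self_mem_nhdsWithin] with d hd
    obtain ⟨e, he, hed⟩ := exists_lt_of_csInf_lt (hSne t ht) (h.trans_lt hd)
    exact he.2.trans (hFmono hed.le)
  have hqmono : MonotoneOn q (Icc 0 T) := fun s hs t ht hst ↦
    (hqle s hs.2 _ (hqa t ht.2)).2 (hst.trans ((hqle t ht.2 _ (hqa t ht.2)).1 le_rfl))
  have hgap : ∀ c d, y a ≤ c → d ≤ y b → c ≤ d →
      d - c ≤ K * (ν.real (Iic d) - ν.real (Iic c)) := by
    intro c d hc hd hcd
    have hsub : Ioc c d ⊆ y '' (y ⁻¹' Ioc c d ∩ Icc 0 T) := by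
      intro u hu
      obtain ⟨t, ht, rfl⟩ := isPreconnected_Icc.intermediate_value ha hb
        hy.continuous.continuousOn ⟨hc.trans hu.1.le, hu.2.trans hd⟩
      exact ⟨t, ⟨hu, ht⟩, rfl⟩
    have h1 := (measure_mono (μ := volume) hsub).trans (by
      simpa [hausdorffMeasure_real] using
        (hy.lipschitzOnWith (s := y ⁻¹' Ioc c d ∩ Icc 0 T)).hausdorffMeasure_image_le
          (d := 1) zero_le_one)
    rw [← hνs _ measurableSet_Ioc, Real.volume_Ioc] at h1
    have h2 := ENNReal.toReal_mono (by finiteness) h1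
    rw [ENNReal.toReal_ofReal (sub_nonneg.2 hcd), ENNReal.toReal_mul, ENNReal.coe_toReal] at h2
    have h3 : ν.real (Ioc c d) = ν.real (Iic d) - ν.real (Iic c) := by
      rw [← Iic_sdiff_Iic, measureReal_sdiff (Iic_subset_Iic.2 hcd) measurableSet_Iic]
    rwa [← h3]
  have hqlip : LipschitzOnWith K q (Icc 0 T) := by
    have key : ∀ s ∈ Icc 0 T, ∀ t ∈ Icc 0 T, s ≤ t → q t ≤ q s + K * (t - s) := by
      intro s hs t ht hst
      refine le_of_forall_lt_imp_le_of_dense fun d hd ↦ ?_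
      rcases le_total d (q s) with h | h
      · exact h.trans (le_add_of_nonneg_right (mul_nonneg K.2 (sub_nonneg.2 hst)))
      have hsa := hqa s hs.2
      have hqtb : q t ≤ y b := (hqle t ht.2 _ (hmin hb)).2 (ht.2.trans hFb.ge)
      have h1 := hgap (q s) d hsa (hd.le.trans hqtb) h
      have h2 := (hqle s hs.2 _ hsa).1 le_rfl
      have h3 : ν.real (Iic d) < t := not_le.1 fun h' ↦
        hd.not_ge ((hqle t ht.2 d (hsa.trans h)).2 h')
      have h4 : (K : ℝ) * (ν.real (Iic d) - ν.real (Iic (q s))) ≤ K * (t - s) := by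
        gcongr
      linarith
    refine LipschitzOnWith.of_le_add_mul K fun s hs t ht ↦ ?_
    rcases le_total s t with h | h
    · exact (hqmono hs ht h).trans (le_add_of_nonneg_right (by positivity))
    · rw [Real.dist_eq, abs_of_nonneg (sub_nonneg.2 h)]
      exact key t ht s hs h
  have hproj : ∀ t, (projIcc 0 T hT t : ℝ) ∈ Icc 0 T := fun t ↦ (projIcc 0 T hT t).2
  have hzmono : Monotone fun t ↦ q (projIcc 0 T hT t) := fun s t hst ↦
    hqmono (hproj s) (hproj t) (monotone_projIcc hT hst)
  refine ⟨fun t ↦ q (projIcc 0 T hT t), hzmono, ?_, ?_⟩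
  · exact hqlip.comp_projIcc hT
  · refine Measure.ext_of_Iic _ _ fun c ↦ ?_
    rw [Measure.map_apply hzmono.measurable measurableSet_Iic,
      Measure.restrict_apply (hzmono.measurable measurableSet_Iic)]
    rcases lt_or_ge c (y a) with hc | hc
    · rw [hνs _ measurableSet_Iic]
      congr 1
      ext t
      simp only [mem_inter_iff, mem_preimage, mem_Iic, and_congr_left_iff]
      intro ht
      exact iff_of_false (fun h ↦ (h.trans_lt hc).not_ge (hqa _ (hproj t).2))
        (fun h ↦ (h.trans_lt hc).not_ge (hmin ht))
    · have : (fun t ↦ q (projIcc 0 T hT t)) ⁻¹' Iic c ∩ Icc 0 T = Icc 0 (ν.real (Iic c)) := by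
        ext t
        simp only [mem_inter_iff, mem_preimage, mem_Iic]
        constructor
        · rintro ⟨h, ht⟩
          rw [projIcc_of_mem hT ht] at h
          exact ⟨ht.1, (hqle t ht.2 c hc).1 h⟩
        · intro h
          have ht : t ∈ Icc 0 T := ⟨h.1, h.2.trans (hFT c)⟩
          rw [projIcc_of_mem hT ht]
          exact ⟨(hqle t ht.2 c hc).2 h.2, ht⟩
      rw [this, Real.volume_Icc, sub_zero, ofReal_measureReal]

theorem integral_mul_comp_eq_of_condExp_ae_eq {α : Type*} [mα : MeasurableSpace α] {μ : Measure α}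
    [IsFiniteMeasure μ] {y p : α → ℝ} (hy : Measurable y) (hp : Integrable p μ) {g : ℝ → ℝ}
    (hg : μ[p | MeasurableSpace.comap y inferInstance] =ᵐ[μ] g ∘ y) {k : ℝ → ℝ}
    (hk : Measurable k) {C : ℝ} (hkC : ∀ c, |k c| ≤ C) :
    ∫ t, p t * k (y t) ∂μ = ∫ t, g (y t) * k (y t) ∂μ := by
  have hm := hy.comap_le
  have hky : StronglyMeasurable[MeasurableSpace.comap y inferInstance] (k ∘ y) :=
    (hk.comp (comap_measurable y)).stronglyMeasurable
  have hint : Integrable (p * (k ∘ y)) μ :=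
    hp.mul_bdd (c := C) (hk.comp hy).aestronglyMeasurable (.of_forall fun t ↦ hkC (y t))
  have h := condExp_mul_of_stronglyMeasurable_right hky hint hp
  calc ∫ t, p t * k (y t) ∂μ = ∫ t, (μ[p * (k ∘ y) | MeasurableSpace.comap y inferInstance]) t ∂μ :=
        (integral_condExp hm).symm
    _ = ∫ t, g (y t) * k (y t) ∂μ := by
        refine integral_congr_ae ?_
        filter_upwards [h, hg] with t h1 h2
        rw [h1, Pi.mul_apply, h2]
        rfl

/-- A power allocation can be averaged over the level sets of `y`. -/
theorem exists_averaged_power {α : Type*} [mα : MeasurableSpace α] {μ : Measure α}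
    [IsFiniteMeasure μ] {y p1 p2 : α → ℝ} (hy : Measurable y) (hp1 : Measurable p1)
    (hp2 : Measurable p2) {P : ℝ} (hP : 0 ≤ P)
    (hp : ∀ᵐ t ∂μ, 0 ≤ p1 t ∧ 0 ≤ p2 t ∧ p1 t + p2 t ≤ P) :
    ∃ g1 g2 : ℝ → ℝ, Measurable g1 ∧ Measurable g2 ∧
      (∀ c, 0 ≤ g1 c ∧ 0 ≤ g2 c ∧ g1 c + g2 c ≤ P) ∧
      ∀ (k : ℝ → ℝ) (C : ℝ), Measurable k → (∀ c, |k c| ≤ C) →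
        ∫ t, p1 t * k (y t) ∂μ = ∫ t, g1 (y t) * k (y t) ∂μ ∧
        ∫ t, p2 t * k (y t) ∂μ = ∫ t, g2 (y t) * k (y t) ∂μ := by
  have hm := hy.comap_le
  have hi1 : Integrable p1 μ := .of_bound hp1.aestronglyMeasurable P <| by
    filter_upwards [hp] with t ht
    rw [Real.norm_eq_abs, abs_of_nonneg ht.1]; linarith
  have hi2 : Integrable p2 μ := .of_bound hp2.aestronglyMeasurable P <| by
    filter_upwards [hp] with t ht
    rw [Real.norm_eq_abs, abs_of_nonneg ht.2.1]; linarith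
  obtain ⟨g1, hg1, he1⟩ := 
    (stronglyMeasurable_condExp (m := MeasurableSpace.comap y inferInstance) (μ := μ)
      (f := p1)).measurable.exists_eq_measurable_comp
  obtain ⟨g2, hg2, he2⟩ := 
    (stronglyMeasurable_condExp (m := MeasurableSpace.comap y inferInstance) (μ := μ)
      (f := p2)).measurable.exists_eq_measurable_comp
  have hn1 := condExp_nonneg (m := MeasurableSpace.comap y inferInstance) (μ := μ) (f := p1)
    (by filter_upwards [hp] with t ht using ht.1)
  have hn2 := condExp_nonneg (m := MeasurableSpace.comap y inferInstance) (μ := μ) (f := p2)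
    (by filter_upwards [hp] with t ht using ht.2.1)
  have hs : μ[p1 + p2 | MeasurableSpace.comap y inferInstance] ≤ᵐ[μ] fun _ ↦ P := by
    have := condExp_mono (m := MeasurableSpace.comap y inferInstance) (hi1.add hi2)
      (integrable_const (μ := μ) P) (by filter_upwards [hp] with t ht using ht.2.2)
    rwa [condExp_const hm] at this
  have ha := condExp_add hi1 hi2 (MeasurableSpace.comap y inferInstance)
  refine ⟨fun c ↦ max 0 (min (g1 c) P), fun c ↦ max 0 (min (g2 c) (P - max 0 (min (g1 c) P))),
    by fun_prop, by fun_prop, fun c ↦ ⟨le_max_left _ _, le_max_left _ _, ?_⟩,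
    fun k C hk hkC ↦ ⟨integral_mul_comp_eq_of_condExp_ae_eq
      (g := fun c ↦ max 0 (min (g1 c) P)) hy hi1 ?_ hk hkC,
      integral_mul_comp_eq_of_condExp_ae_eq
      (g := fun c ↦ max 0 (min (g2 c) (P - max 0 (min (g1 c) P)))) hy hi2 ?_ hk hkC⟩⟩
  · have h1 : max 0 (min (g1 c) P) ≤ P := max_le hP (min_le_right _ _)
    have h2 : max 0 (min (g2 c) (P - max 0 (min (g1 c) P))) ≤ P - max 0 (min (g1 c) P) :=
      max_le (by linarith) (min_le_right _ _)
    linarith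
  all_goals
    rw [he1] at hn1 ha
    rw [he2] at hn2 ha
    filter_upwards [hn1, hn2, hs, ha] with t h1 h2 h3 h4
    simp only [Function.comp_apply, Pi.zero_apply, Pi.add_apply] at h1 h2 h3 h4 ⊢
    rw [h4] at h3
  · rw [he1, min_eq_left (by linarith), max_eq_right h1]; rfl
  · rw [he2, min_eq_left (a := g1 _) (by linarith), max_eq_right h1, min_eq_left (by linarith),
      max_eq_right h2]; rfl

/-- Jensen's inequality for the averaged power allocation. -/
theorem integral_logb_le_of_averaged {α : Type*} [mα : MeasurableSpace α] {μ : Measure α}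
    [IsFiniteMeasure μ] {y p1 p2 : α → ℝ} (hy : Measurable y) (hp1 : Measurable p1)
    (hp2 : Measurable p2) {P : ℝ} (hp : ∀ᵐ t ∂μ, 0 ≤ p1 t ∧ 0 ≤ p2 t ∧ p1 t + p2 t ≤ P)
    {g1 g2 : ℝ → ℝ} (hg1 : Measurable g1) (hg2 : Measurable g2)
    (hg : ∀ c, 0 ≤ g1 c ∧ 0 ≤ g2 c ∧ g1 c + g2 c ≤ P)
    (havg : ∀ (k : ℝ → ℝ) (C : ℝ), Measurable k → (∀ c, |k c| ≤ C) →
        ∫ t, p1 t * k (y t) ∂μ = ∫ t, g1 (y t) * k (y t) ∂μ ∧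
        ∫ t, p2 t * k (y t) ∂μ = ∫ t, g2 (y t) * k (y t) ∂μ)
    {w1 w2 : ℝ → ℝ} (hw1 : Measurable w1) (hw2 : Measurable w2) {C : ℝ}
    (hw : ∀ c, 0 ≤ w1 c ∧ w1 c ≤ C ∧ 0 ≤ w2 c ∧ w2 c ≤ C) :
    ∫ t, Real.logb 2 (1 + p1 t * w1 (y t) + p2 t * w2 (y t)) ∂μ ≤
      ∫ t, Real.logb 2 (1 + g1 (y t) * w1 (y t) + g2 (y t) * w2 (y t)) ∂μ := by
  have hC : 0 ≤ C := (hw 0).1.trans (hw 0).2.1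
  have hlog2 : 0 < Real.log 2 := Real.log_pos one_lt_two
  -- integrability of the rates
  have hlogint : ∀ a b : α → ℝ, Measurable a → Measurable b →
      (∀ᵐ t ∂μ, 0 ≤ a t ∧ 0 ≤ b t ∧ a t + b t ≤ P) →
      Integrable (fun t ↦ Real.logb 2 (1 + a t * w1 (y t) + b t * w2 (y t))) μ := by
    intro a b ha hb hab
    refine .of_bound (C := P * C / Real.log 2) ?_ ?_
    · refine Measurable.aestronglyMeasurable ?_
      unfold Real.logb
      fun_prop
    filter_upwards [hab] with t ht
    obtain ⟨hw1, hw1', hw2, hw2'⟩ := hw (y t)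
    have h1 := mul_nonneg ht.1 hw1
    have h2 := mul_nonneg ht.2.1 hw2
    have h3 := mul_le_mul_of_nonneg_left hw1' ht.1
    have h4 := mul_le_mul_of_nonneg_left hw2' ht.2.1
    have h5 := mul_le_mul_of_nonneg_right ht.2.2 hC
    have h6 := Real.log_le_sub_one_of_pos (x := 1 + a t * w1 (y t) + b t * w2 (y t)) (by linarith)
    rw [Real.norm_eq_abs, abs_of_nonneg (Real.logb_nonneg one_lt_two (by linarith)), Real.logb]
    gcongr
    linarith
  have hI1 := hlogint p1 p2 hp1 hp2 hp
  have hI2 := hlogint _ _ (hg1.comp hy) (hg2.comp hy) (.of_forall fun t ↦ hg (y t))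
  -- weights of the tangent line
  set den : ℝ → ℝ := fun c ↦ (1 + g1 c * w1 c + g2 c * w2 c) * Real.log 2 with hden
  have hB : ∀ c, 1 ≤ 1 + g1 c * w1 c + g2 c * w2 c := fun c ↦ by
    have h1 := mul_nonneg (hg c).1 (hw c).1
    have h2 := mul_nonneg (hg c).2.1 (hw c).2.2.1
    linarith
  have hdenpos : ∀ c, 0 < den c := fun c ↦ mul_pos (by linarith [hB c]) hlog2
  have hk : ∀ w : ℝ → ℝ, (∀ c, 0 ≤ w c ∧ w c ≤ C) → ∀ c, |w c / den c| ≤ C / Real.log 2 := by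
    intro w hw c
    rw [abs_of_nonneg (div_nonneg (hw c).1 (hdenpos c).le)]
    exact div_le_div₀ hC (hw c).2 hlog2 (le_mul_of_one_le_left hlog2.le (hB c))
  have hb1 := hk w1 fun c ↦ ⟨(hw c).1, (hw c).2.1⟩
  have hb2 := hk w2 fun c ↦ ⟨(hw c).2.2.1, (hw c).2.2.2⟩
  have hm1 : Measurable fun c ↦ w1 c / den c := by fun_prop
  have hm2 : Measurable fun c ↦ w2 c / den c := by fun_prop
  have hprod : ∀ (a : α → ℝ) (k : ℝ → ℝ), Measurable a → (∀ᵐ t ∂μ, 0 ≤ a t ∧ a t ≤ P) →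
      Measurable k → (∀ c, |k c| ≤ C / Real.log 2) → Integrable (fun t ↦ a t * k (y t)) μ := by
    intro a k ha haP hk hkC
    refine Integrable.mul_bdd (c := C / Real.log 2) (.of_bound ha.aestronglyMeasurable P ?_)
      (hk.comp hy).aestronglyMeasurable (.of_forall fun t ↦ hkC (y t))
    filter_upwards [haP] with t ht
    rw [Real.norm_eq_abs, abs_of_nonneg ht.1]
    exact ht.2
  have i1 := hprod p1 _ hp1 (by filter_upwards [hp] with t ht using ⟨ht.1, by linarith⟩) hm1 hb1
  have i2 := hprod p2 _ hp2 (by filter_upwards [hp] with t ht using ⟨ht.2.1, by linarith⟩) hm2 hb2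
  have i3 := hprod (fun t ↦ g1 (y t)) _ (hg1.comp hy)
    (.of_forall fun t ↦ ⟨(hg (y t)).1, by linarith [hg (y t)]⟩) hm1 hb1
  have i4 := hprod (fun t ↦ g2 (y t)) _ (hg2.comp hy)
    (.of_forall fun t ↦ ⟨(hg (y t)).2.1, by linarith [hg (y t)]⟩) hm2 hb2
  have e1 := (havg _ _ hm1 hb1).1
  have e2 := (havg _ _ hm2 hb2).2
  have hle : ∫ t, Real.logb 2 (1 + p1 t * w1 (y t) + p2 t * w2 (y t)) ∂μ ≤
      ∫ t, (Real.logb 2 (1 + g1 (y t) * w1 (y t) + g2 (y t) * w2 (y t)) +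
        ((p1 t * (w1 (y t) / den (y t)) - g1 (y t) * (w1 (y t) / den (y t))) +
        (p2 t * (w2 (y t) / den (y t)) - g2 (y t) * (w2 (y t) / den (y t))))) ∂μ := by
    refine integral_mono_ae hI1 (hI2.add ((i1.sub i3).add (i2.sub i4))) ?_
    filter_upwards [hp] with t ht
    have hBt := hB (y t)
    have h1 := mul_nonneg ht.1 (hw (y t)).1
    have h2 := mul_nonneg ht.2.1 (hw (y t)).2.2.1
    simp only [hden]
    generalize g1 (y t) = G1, g2 (y t) = G2, w1 (y t) = W1, w2 (y t) = W2 at *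
    have hB0 : 0 < 1 + G1 * W1 + G2 * W2 := by linarith
    have hA0 : 0 < 1 + p1 t * W1 + p2 t * W2 := by linarith
    have h := Real.log_le_sub_one_of_pos (div_pos hA0 hB0)
    rw [Real.log_div hA0.ne' hB0.ne'] at h
    unfold Real.logb
    calc Real.log (1 + p1 t * W1 + p2 t * W2) / Real.log 2
        ≤ (Real.log (1 + G1 * W1 + G2 * W2) +
          ((1 + p1 t * W1 + p2 t * W2) / (1 + G1 * W1 + G2 * W2) - 1)) / Real.log 2 := by
          gcongr
          linarith
      _ = _ := by
          field_simp
          ring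
  have e3 := integral_add hI2 ((i1.sub i3).add (i2.sub i4))
  have e4 := integral_add (i1.sub i3) (i2.sub i4)
  have e5 := integral_sub i1 i3
  have e6 := integral_sub i2 i4
  simp only [Pi.sub_apply, Pi.add_apply, Function.comp_apply] at e3 e4
  rw [e3, e4, e5, e6, e1, e2] at hle
  simpa using hle

/-- Every point of the capacity region is achievable by a
unidirectional (nondecreasing) feasible trajectory. -/
theorem unidirectional_trajectory_optimal (D H β0 P V T : ℝ)
    (hD : 0 < D) (hH : 0 < H) (hβ : 0 < β0) (hP : 0 < P) (hV : 0 ≤ V) (hT : 0 < T) :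
    ∀ r ∈ CapacityRegion D H β0 P V T, ∃ x p1 p2,
      FeasibleTraj V T x ∧ MonotoneOn x (Set.Icc (0 : ℝ) T) ∧
      FeasiblePower P T p1 p2 ∧
      Achievable D H β0 T x p1 p2 r.1 r.2 := by
  rintro ⟨r1, r2⟩ ⟨x, p1, p2, hx, ⟨hp1, hp2, hp⟩, hr1, hr2, hb1, hb2, hb⟩
  set μ : Measure ℝ := volume.restrict (Set.Icc 0 T) with hμ
  have hI : ∀ f : ℝ → ℝ, ∫ t in (0 : ℝ)..T, f t = ∫ t, f t ∂μ := fun f ↦ by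
    rw [intervalIntegral.integral_of_le hT.le, hμ, integral_Icc_eq_integral_Ioc]
  have hxlip : LipschitzOnWith ⟨V, hV⟩ x (Set.Icc 0 T) :=
    LipschitzOnWith.of_dist_le_mul fun s hs t ht ↦ hx s hs t ht
  set y : ℝ → ℝ := fun t ↦ x (Set.projIcc 0 T hT.le t) with hy
  have hylip : LipschitzWith ⟨V, hV⟩ y := hxlip.comp_projIcc hT.le
  have hym : Measurable y := hylip.continuous.measurable
  have hxy : ∀ t ∈ Set.Icc 0 T, x t = y t := fun t ht ↦ by simp [hy, Set.projIcc_of_mem hT.le ht]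
  have hIxy : ∀ F : ℝ → ℝ → ℝ, ∫ t in (0 : ℝ)..T, F t (x t) = ∫ t, F t (y t) ∂μ := fun F ↦ by
    rw [hI]
    exact setIntegral_congr_fun measurableSet_Icc fun t ht ↦ by simp only [hxy t ht]
  obtain ⟨z, hzmono, hzlip, hzmap⟩ := exists_monotone_lipschitz_rearrangement hT.le hylip
  have hpae : ∀ᵐ t ∂μ, 0 ≤ p1 t ∧ 0 ≤ p2 t ∧ p1 t + p2 t ≤ P :=
    (ae_restrict_iff' measurableSet_Icc).2 (.of_forall hp)
  obtain ⟨g1, g2, hg1, hg2, hg, havg⟩ := exists_averaged_power hym hp1 hp2 hP.le hpae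
  have hgain : ∀ a : ℝ, Measurable (fun c : ℝ ↦ β0 / ((c + a) ^ 2 + H ^ 2)) ∧
      ∀ c : ℝ, 0 ≤ β0 / ((c + a) ^ 2 + H ^ 2) ∧ β0 / ((c + a) ^ 2 + H ^ 2) ≤ β0 / H ^ 2 :=
    fun a ↦ ⟨by fun_prop, fun c ↦ ⟨by positivity, by
      gcongr
      exact le_add_of_nonneg_left (sq_nonneg _)⟩⟩
  have hm1 : Measurable (h1 D H β0) := (hgain (D / 2)).1
  have hm2 : Measurable (h2 D H β0) := (hgain (-(D / 2))).1
  have hh1 : ∀ c, 0 ≤ h1 D H β0 c ∧ h1 D H β0 c ≤ β0 / H ^ 2 := (hgain (D / 2)).2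
  have hh2 : ∀ c, 0 ≤ h2 D H β0 c ∧ h2 D H β0 c ≤ β0 / H ^ 2 := (hgain (-(D / 2))).2
  have hC : 0 ≤ β0 / H ^ 2 := by positivity
  have htrans : ∀ G : ℝ → ℝ, Measurable G → ∫ t, G (y t) ∂μ = ∫ t in (0 : ℝ)..T, G (z t) :=
    fun G hG ↦ by
      rw [hI, ← integral_map hym.aemeasurable hG.aestronglyMeasurable, ← hzmap,
        integral_map hzmono.measurable.aemeasurable hG.aestronglyMeasurable]
  have hrate : ∀ w1 w2 : ℝ → ℝ, Measurable w1 → Measurable w2 →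
      (∀ c, 0 ≤ w1 c ∧ w1 c ≤ β0 / H ^ 2) → (∀ c, 0 ≤ w2 c ∧ w2 c ≤ β0 / H ^ 2) →
      (1 / T) * ∫ t in (0 : ℝ)..T, Real.logb 2 (1 + p1 t * w1 (x t) + p2 t * w2 (x t)) ≤
      (1 / T) * ∫ t in (0 : ℝ)..T,
        Real.logb 2 (1 + g1 (z t) * w1 (z t) + g2 (z t) * w2 (z t)) := by
    intro w1 w2 hw1 hw2 hb1 hb2
    refine mul_le_mul_of_nonneg_left ?_ (by positivity)
    rw [hIxy fun t c ↦ Real.logb 2 (1 + p1 t * w1 c + p2 t * w2 c),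
      ← htrans (fun c ↦ Real.logb 2 (1 + g1 c * w1 c + g2 c * w2 c))
        (by unfold Real.logb; fun_prop)]
    exact integral_logb_le_of_averaged hym hp1 hp2 hpae hg1 hg2 hg havg hw1 hw2
      fun c ↦ ⟨(hb1 c).1, (hb1 c).2, hb2 c⟩
  have hzero : ∀ c : ℝ, 0 ≤ (fun _ : ℝ ↦ (0 : ℝ)) c ∧ (fun _ : ℝ ↦ (0 : ℝ)) c ≤ β0 / H ^ 2 :=
    fun _ ↦ ⟨le_rfl, hC⟩
  refine ⟨z, g1 ∘ z, g2 ∘ z, fun s _ t _ ↦ hzlip.dist_le_mul s t, hzmono.monotoneOn _,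
    ⟨hg1.comp hzmono.measurable, hg2.comp hzmono.measurable, fun t _ ↦ hg (z t)⟩,
    hr1, hr2, hb1.trans ?_, hb2.trans ?_, hb.trans (hrate _ _ hm1 hm2 hh1 hh2)⟩
  · simpa using hrate _ _ hm1 measurable_const hh1 hzero
  · simpa using hrate _ _ measurable_const hm2 hzero hh2
end

section
/- Let Ĉ(P̄) denote the set of all pairs (r1, r2) achievable for some measurable trajectory x : [0,T] → ℝ (no speed constraint) and some feasible power allocation. Then Ĉ(P̄) = { (r1, r2) : r1 ≥ 0, r2 ≥ 0, r1 + r2 ≤ log2(1 + P̄β0/H²) }, i.e., the capacity region of the UAV-enabled two-user broadcast channel in the absence of the speed constraint is exactly this triangle. -/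
open MeasureTheory

/-- The capacity region of the UAV-enabled two-user BC without the speed
constraint: the trajectory is only required to be measurable. -/
def CapacityRegionNoSpeed (D H β0 P T : ℝ) : Set (ℝ × ℝ) :=
  {r | ∃ x p1 p2, Measurable x ∧ FeasiblePower P T p1 p2 ∧
    Achievable D H β0 T x p1 p2 r.1 r.2}

/-- The interval integral of a step function with a single jump. -/
theorem integral_ite_le_const {T τ a b : ℝ} (h0 : 0 ≤ τ) (hT : τ ≤ T) :
    ∫ t in (0 : ℝ)..T, (if t ≤ τ then a else b) = τ * a + (T - τ) * b := by
  have left : Set.EqOn (fun _ => a) (fun t : ℝ => if t ≤ τ then a else b) (Set.uIoc 0 τ) := by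
    intro t ht
    rw [Set.uIoc_of_le h0] at ht
    simp [ht.2]
  have right : Set.EqOn (fun _ => b) (fun t : ℝ => if t ≤ τ then a else b) (Set.uIoc τ T) := by
    intro t ht
    rw [Set.uIoc_of_le hT] at ht
    simp [not_le.mpr ht.1]
  rw [← intervalIntegral.integral_add_adjacent_intervals
      (intervalIntegrable_const.congr left) (intervalIntegrable_const.congr right),
    ← intervalIntegral.integral_congr_ae (Filter.Eventually.of_forall left),
    ← intervalIntegral.integral_congr_ae (Filter.Eventually.of_forall right)]
  simp

/-- A channel gain is nonnegative and at most its value right above the user. -/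
theorem div_sq_add_sq_mem_Icc {β0 H : ℝ} (hβ : 0 < β0) (hH : 0 < H) (y : ℝ) :
    β0 / (y ^ 2 + H ^ 2) ∈ Set.Icc 0 (β0 / H ^ 2) :=
  ⟨by positivity, by gcongr; nlinarith [sq_nonneg y]⟩

theorem add_le_of_achievable {D H β0 P T : ℝ} (hH : 0 < H) (hβ : 0 < β0) (hT : 0 < T)
    {x p1 p2 : ℝ → ℝ} (hp : FeasiblePower P T p1 p2) {r1 r2 : ℝ}
    (h : Achievable D H β0 T x p1 p2 r1 r2) :
    r1 + r2 ≤ Real.logb 2 (1 + P * β0 / H ^ 2) := by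
  have bound : ∀ t ∈ Set.uIoc 0 T,
      ‖Real.logb 2 (1 + p1 t * h1 D H β0 (x t) + p2 t * h2 D H β0 (x t))‖ ≤
        Real.logb 2 (1 + P * β0 / H ^ 2) := by
    intro t ht
    rw [Set.uIoc_of_le hT.le] at ht
    obtain ⟨hp1, hp2, hsum⟩ := hp.2.2 t ⟨ht.1.le, ht.2⟩
    obtain ⟨g1, g1'⟩ : h1 D H β0 (x t) ∈ Set.Icc 0 (β0 / H ^ 2) := div_sq_add_sq_mem_Icc hβ hH _
    obtain ⟨g2, g2'⟩ : h2 D H β0 (x t) ∈ Set.Icc 0 (β0 / H ^ 2) := div_sq_add_sq_mem_Icc hβ hH _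
    have e1 := mul_nonneg hp1 g1
    have e2 := mul_nonneg hp2 g2
    have f1 := mul_le_mul_of_nonneg_left g1' hp1
    have f2 := mul_le_mul_of_nonneg_left g2' hp2
    have f3 := mul_le_mul_of_nonneg_right hsum (g1.trans g1')
    rw [Real.norm_of_nonneg (Real.logb_nonneg one_lt_two (by linarith))]
    refine Real.logb_le_logb_of_le one_lt_two (by linarith) ?_
    rw [mul_div_assoc]
    linarith
  have key := (le_abs_self _).trans (intervalIntegral.norm_integral_le_of_norm_le_const bound)
  rw [sub_zero, abs_of_pos hT] at key
  refine h.2.2.2.2.trans ?_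
  rw [one_div, inv_mul_le_iff₀ hT, mul_comm]
  exact key

/-- Hovering above user 1 until time `τ` and above user 2 afterwards, always serving only the
user below at full power, reaches every point of the triangle. -/
theorem exists_achievable_of_add_le {D H β0 P T : ℝ} (hH : 0 < H) (hβ : 0 < β0) (hP : 0 < P)
    (hT : 0 < T) {r1 r2 : ℝ} (hr1 : 0 ≤ r1) (hr2 : 0 ≤ r2)
    (hr : r1 + r2 ≤ Real.logb 2 (1 + P * β0 / H ^ 2)) :
    ∃ x p1 p2, Measurable x ∧ FeasiblePower P T p1 p2 ∧ Achievable D H β0 T x p1 p2 r1 r2 := by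
  set C := Real.logb 2 (1 + P * β0 / H ^ 2) with hC
  have hCpos : 0 < C :=
    Real.logb_pos one_lt_two (by linarith [show 0 < P * β0 / H ^ 2 by positivity])
  set τ := T * r1 / C with hτ
  have hτ0 : 0 ≤ τ := by positivity
  have hτT : τ ≤ T := by
    rw [hτ, div_le_iff₀ hCpos]
    exact mul_le_mul_of_nonneg_left (by linarith) hT.le
  have hτC : τ * C = T * r1 := by rw [hτ]; field_simp
  have hs : MeasurableSet {t : ℝ | t ≤ τ} := measurableSet_Iic
  refine ⟨fun t => if t ≤ τ then -(D / 2) else D / 2, fun t => if t ≤ τ then P else 0,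
    fun t => if t ≤ τ then 0 else P, Measurable.ite hs measurable_const measurable_const,
    ⟨Measurable.ite hs measurable_const measurable_const,
      Measurable.ite hs measurable_const measurable_const, ?_⟩, hr1, hr2, ?_, ?_, ?_⟩
  · intro t _
    dsimp only
    split_ifs <;> simp [hP.le]
  · rw [intervalIntegral.integral_congr (g := fun t => if t ≤ τ then C else 0)
      (fun t _ => by dsimp only; split_ifs <;> simp [h1, hC, mul_div_assoc]),
      integral_ite_le_const hτ0 hτT, one_div, le_inv_mul_iff₀ hT]
    linarith
  · rw [intervalIntegral.integral_congr (g := fun t => if t ≤ τ then 0 else C)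
      (fun t _ => by dsimp only; split_ifs <;> simp [h2, hC, mul_div_assoc]),
      integral_ite_le_const hτ0 hτT, one_div, le_inv_mul_iff₀ hT]
    linarith [mul_le_mul_of_nonneg_left hr hT.le]
  · rw [intervalIntegral.integral_congr (g := fun t => if t ≤ τ then C else C)
      (fun t _ => by dsimp only; split_ifs <;> simp [h1, h2, hC, mul_div_assoc]),
      integral_ite_le_const hτ0 hτT, one_div, le_inv_mul_iff₀ hT]
    linarith [mul_le_mul_of_nonneg_left hr hT.le]

/-- In the absence of the UAV speed constraint, the capacity
region is exactly the triangle
`{(r1, r2) : r1 ≥ 0, r2 ≥ 0, r1 + r2 ≤ log2(1 + P β0 / H²)}`. -/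
theorem capacity_region_no_speed_constraint (D H β0 P T : ℝ)
    (hD : 0 < D) (hH : 0 < H) (hβ : 0 < β0) (hP : 0 < P) (hT : 0 < T) :
    CapacityRegionNoSpeed D H β0 P T =
      {r : ℝ × ℝ | 0 ≤ r.1 ∧ 0 ≤ r.2 ∧
        r.1 + r.2 ≤ Real.logb 2 (1 + P * β0 / H ^ 2)} := by
  ext r
  constructor
  · rintro ⟨x, p1, p2, _, hp, h⟩
    exact ⟨h.1, h.2.1, add_le_of_achievable hH hβ hT hp h⟩
  · rintro ⟨hr1, hr2, hr⟩
    exact exists_achievable_of_add_le hH hβ hP hT hr1 hr2 hr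
end

section
/- Let V > 0, T > D/V, α ∈ [0,1], and C0 = log2(1 + P̄β0/H²). Consider the HFH trajectory with x_I = -D/2, x_F = D/2, t_I = α(T - D/V), t_F = (1-α)(T - D/V), and the TDMA power allocation p1(t) = P̄, p2(t) = 0 for t ∈ [0, t_I], p1(t) = p2(t) = 0 for t ∈ (t_I, T - t_F), and p1(t) = 0, p2(t) = P̄ for t ∈ [T - t_F, T]. Then this trajectory is V-Lipschitz, the power allocation is feasible, and the rate pair ( α(1 - D/(VT))·C0 , (1-α)(1 - D/(VT))·C0 ) is achievable for this trajectory and power allocation; hence it belongs to C(V,T,P̄). -/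
open MeasureTheory

/-- The hover-fly-hover (HFH) trajectory: hover at `xI` during `[0, tI]`, fly at
speed `V` during `(tI, T - tF)`, hover at `xF` during `[T - tF, T]`. -/
noncomputable def hfh (V T xI xF tI tF : ℝ) : ℝ → ℝ := fun t =>
  if t ≤ tI then xI else if t < T - tF then xI + V * (t - tI) else xF

/-- The trajectory at time `t` is `xI + V * c`, with `c` the time flown so far. -/
theorem hfh_eq_clamp {V T xI xF tI tF : ℝ} (h : tI ≤ T - tF)
    (hx : xI + V * (T - tF - tI) = xF) (t : ℝ) :
    hfh V T xI xF tI tF t = xI + V * max 0 (min (t - tI) (T - tF - tI)) := by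
  unfold hfh
  split_ifs with h₁ h₂
  · rw [max_eq_left (min_le_of_left_le (by linarith))]
    ring
  · rw [min_eq_left (by linarith), max_eq_right (by linarith)]
  · rw [min_eq_right (by linarith), max_eq_right (by linarith), hx]

theorem feasibleTraj_hfh {V T xI xF tI tF : ℝ} (hV : 0 ≤ V) (h : tI ≤ T - tF)
    (hx : xI + V * (T - tF - tI) = xF) : FeasibleTraj V T (hfh V T xI xF tI tF) := by
  intro s _ t _
  rw [hfh_eq_clamp h hx, hfh_eq_clamp h hx, add_sub_add_left_eq_sub, ← mul_sub, abs_mul,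
    abs_of_nonneg hV]
  refine mul_le_mul_of_nonneg_left ?_ hV
  calc |max 0 (min (s - tI) (T - tF - tI)) - max 0 (min (t - tI) (T - tF - tI))|
      ≤ |min (s - tI) (T - tF - tI) - min (t - tI) (T - tF - tI)| := by
        simpa using abs_max_sub_max_le_max 0 (min (s - tI) (T - tF - tI)) 0
          (min (t - tI) (T - tF - tI))
    _ ≤ |s - t| := by
        simpa using abs_min_sub_min_le_max (s - tI) (T - tF - tI) (t - tI) (T - tF - tI)

theorem intervalIntegrable_ite_le (a T c : ℝ) :
    IntervalIntegrable (fun t => if t ≤ a then c else 0) volume 0 T :=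
  (intervalIntegrable_const (c := c)).mono_fun
    (Measurable.ite measurableSet_Iic measurable_const measurable_const).aestronglyMeasurable
    (.of_forall fun t => by dsimp only; split_ifs <;> simp)

theorem intervalIntegrable_ite_ge (a T c : ℝ) :
    IntervalIntegrable (fun t => if a ≤ t then c else 0) volume 0 T :=
  (intervalIntegrable_const (c := c)).mono_fun
    (Measurable.ite measurableSet_Ici measurable_const measurable_const).aestronglyMeasurable
    (.of_forall fun t => by dsimp only; split_ifs <;> simp)

theorem integral_ite_le {a T : ℝ} (ha : 0 ≤ a) (haT : a ≤ T) (c : ℝ) :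
    ∫ t in (0 : ℝ)..T, (if t ≤ a then c else 0) = a * c := by
  have hi : (fun t : ℝ => if t ≤ a then c else 0) = {t | t ≤ a}.indicator fun _ => c := by
    ext t
    simp [Set.indicator_apply]
  rw [hi, intervalIntegral.integral_indicator ⟨ha, haT⟩]
  simp

theorem integral_ite_ge {a T : ℝ} (ha : 0 ≤ a) (haT : a ≤ T) (c : ℝ) :
    ∫ t in (0 : ℝ)..T, (if a ≤ t then c else 0) = (T - a) * c := by
  have h := intervalIntegral.integral_comp_sub_left
    (fun t : ℝ => if t ≤ T - a then c else 0) (a := 0) (b := T) T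
  rw [sub_self, sub_zero, integral_ite_le (by linarith) (by linarith)] at h
  simpa only [sub_le_sub_iff_left] using h

/-- For `V > 0` and `T > D/V`, the HFH trajectory between the two
users with hovering times `α (T - D/V)` and `(1 - α)(T - D/V)`, together with the
TDMA power allocation (full power to user 1 while hovering over it, full power to
user 2 while hovering over it, silence while flying), achieves the rate pair
`(α (1 - D/(V T)) C0, (1 - α)(1 - D/(V T)) C0)`; hence this pair lies in
`C(V, T, P)`. -/
theorem hfh_tdma_achievable (D H β0 P V T α : ℝ)
    (hD : 0 < D) (hH : 0 < H) (hβ : 0 < β0) (hP : 0 < P) (hV : 0 < V)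
    (hT : D / V < T) (hα0 : 0 ≤ α) (hα1 : α ≤ 1) :
    FeasibleTraj V T
      (hfh V T (-(D / 2)) (D / 2) (α * (T - D / V)) ((1 - α) * (T - D / V))) ∧
    FeasiblePower P T
      (fun t => if t ≤ α * (T - D / V) then P else 0)
      (fun t => if T - (1 - α) * (T - D / V) ≤ t then P else 0) ∧
    Achievable D H β0 T
      (hfh V T (-(D / 2)) (D / 2) (α * (T - D / V)) ((1 - α) * (T - D / V)))
      (fun t => if t ≤ α * (T - D / V) then P else 0)
      (fun t => if T - (1 - α) * (T - D / V) ≤ t then P else 0)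
      (α * (1 - D / (V * T)) * Real.logb 2 (1 + P * β0 / H ^ 2))
      ((1 - α) * (1 - D / (V * T)) * Real.logb 2 (1 + P * β0 / H ^ 2)) ∧
    (α * (1 - D / (V * T)) * Real.logb 2 (1 + P * β0 / H ^ 2),
      (1 - α) * (1 - D / (V * T)) * Real.logb 2 (1 + P * β0 / H ^ 2)) ∈
      CapacityRegion D H β0 P V T := by
  have hDV : 0 < D / V := div_pos hD hV
  have hT0 : 0 < T := hDV.trans hT
  have hα : 0 ≤ 1 - α := by linarith
  have hVD : V * (D / V) = D := mul_div_cancel₀ D hV.ne'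
  have hratio : (1 - D / (V * T)) = (T - D / V) / T := by field_simp
  have ha : 0 ≤ α * (T - D / V) := mul_nonneg hα0 (by linarith)
  have hb : 0 ≤ (1 - α) * (T - D / V) := mul_nonneg hα (by linarith)
  have hsum : T - (1 - α) * (T - D / V) - α * (T - D / V) = D / V := by ring
  rw [hratio]
  set a := α * (T - D / V) with ha_def
  set b := (1 - α) * (T - D / V) with hb_def
  set C := Real.logb 2 (1 + P * β0 / H ^ 2) with hC_def
  have hC : 0 ≤ C := Real.logb_nonneg one_lt_two (le_add_of_nonneg_right (by positivity))
  have hr₁ : α * ((T - D / V) / T) * C = 1 / T * (a * C) := by rw [ha_def]; ring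
  have hr₂ : (1 - α) * ((T - D / V) / T) * C = 1 / T * (b * C) := by rw [hb_def]; ring
  rw [hr₁, hr₂]
  have htraj : FeasibleTraj V T (hfh V T (-(D / 2)) (D / 2) a b) :=
    feasibleTraj_hfh hV.le (by linarith) (by rw [hsum, hVD]; ring)
  have hpow : FeasiblePower P T (fun t => if t ≤ a then P else 0)
      (fun t => if T - b ≤ t then P else 0) := by
    refine ⟨Measurable.ite measurableSet_Iic measurable_const measurable_const,
      Measurable.ite measurableSet_Ici measurable_const measurable_const, fun t _ => ?_⟩
    dsimp only
    split_ifs <;> refine ⟨?_, ?_, ?_⟩ <;> linarith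
  have hrate₁ (t : ℝ) : Real.logb 2 (1 + (if t ≤ a then P else 0) *
      h1 D H β0 (hfh V T (-(D / 2)) (D / 2) a b t)) = if t ≤ a then C else 0 := by
    split_ifs with h
    · simp [hfh, h, h1, hC_def, mul_div_assoc]
    · simp
  have hrate₂ (t : ℝ) : Real.logb 2 (1 + (if T - b ≤ t then P else 0) *
      h2 D H β0 (hfh V T (-(D / 2)) (D / 2) a b t)) = if T - b ≤ t then C else 0 := by
    split_ifs with h
    · have hta : ¬t ≤ a := by linarith
      simp only [hfh, if_neg hta, if_neg h.not_gt, h2, hC_def, sub_self, mul_div_assoc]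
      simp
    · simp
  have hrate (t : ℝ) : Real.logb 2 (1 + (if t ≤ a then P else 0) *
        h1 D H β0 (hfh V T (-(D / 2)) (D / 2) a b t) + (if T - b ≤ t then P else 0) *
        h2 D H β0 (hfh V T (-(D / 2)) (D / 2) a b t)) =
      (if t ≤ a then C else 0) + if T - b ≤ t then C else 0 := by
    rw [← hrate₁, ← hrate₂]
    by_cases h : t ≤ a
    · have htb : ¬T - b ≤ t := by linarith
      simp [htb]
    · simp [h]
  have hint₁ := integral_ite_le ha (by linarith : a ≤ T) C
  have hint₂ := integral_ite_ge (by linarith : 0 ≤ T - b) (by linarith : T - b ≤ T) C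
  rw [sub_sub_cancel] at hint₂
  have hach : Achievable D H β0 T (hfh V T (-(D / 2)) (D / 2) a b)
      (fun t => if t ≤ a then P else 0) (fun t => if T - b ≤ t then P else 0)
      (1 / T * (a * C)) (1 / T * (b * C)) := by
    refine ⟨by positivity, by positivity, ?_, ?_, ?_⟩
    · simp only [hrate₁, hint₁, le_refl]
    · simp only [hrate₂, hint₂, le_refl]
    · simp only [hrate]
      rw [intervalIntegral.integral_add (intervalIntegrable_ite_le a T C)
        (intervalIntegrable_ite_ge (T - b) T C), hint₁, hint₂, mul_add]
  exact ⟨htraj, hpow, hach, _, _, _, htraj, hpow, hach⟩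
end

section
/- Fix V > 0 and set C0 = log2(1 + P̄β0/H²). Then: (i) for every T > 0, C(V,T,P̄) ⊆ { (r1, r2) : r1 ≥ 0, r2 ≥ 0, r1 + r2 ≤ C0 }; and (ii) for every pair (r1, r2) with r1 ≥ 0, r2 ≥ 0, and r1 + r2 < C0, there exists T0 > 0 such that (r1, r2) ∈ C(V,T,P̄) for all T ≥ T0. Hence, as the flight duration T → ∞, the capacity region converges to the triangle { r1 ≥ 0, r2 ≥ 0, r1 + r2 ≤ C0 }, which is achieved by a hover-fly-hover trajectory with hovering locations above the two users together with TDMA-based transmission. -/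
open MeasureTheory

theorem h1_bounds (D β0 x : ℝ) {H : ℝ} (hH : 0 < H) (hβ : 0 < β0) :
    0 ≤ h1 D H β0 x ∧ h1 D H β0 x ≤ β0 / H ^ 2 := by
  unfold h1
  refine ⟨by positivity, ?_⟩
  gcongr
  nlinarith [sq_nonneg (x + D / 2)]

theorem h2_bounds (D β0 x : ℝ) {H : ℝ} (hH : 0 < H) (hβ : 0 < β0) :
    0 ≤ h2 D H β0 x ∧ h2 D H β0 x ≤ β0 / H ^ 2 := by
  unfold h2
  refine ⟨by positivity, ?_⟩
  gcongr
  nlinarith [sq_nonneg (x - D / 2)]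

/-- The instantaneous sum rate lies between `0` and the rate from directly above a user. -/
theorem logb_sum_rate_bounds (D β0 x : ℝ) {H P q1 q2 : ℝ} (hH : 0 < H) (hβ : 0 < β0)
    (hq1 : 0 ≤ q1) (hq2 : 0 ≤ q2) (hq : q1 + q2 ≤ P) :
    0 ≤ Real.logb 2 (1 + q1 * h1 D H β0 x + q2 * h2 D H β0 x) ∧
      Real.logb 2 (1 + q1 * h1 D H β0 x + q2 * h2 D H β0 x) ≤
        Real.logb 2 (1 + P * β0 / H ^ 2) := by
  obtain ⟨a0, a1⟩ := h1_bounds D β0 x hH hβ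
  obtain ⟨b0, b1⟩ := h2_bounds D β0 x hH hβ
  have e1 := mul_nonneg hq1 a0
  have e2 := mul_nonneg hq2 b0
  refine ⟨Real.logb_nonneg one_lt_two (by linarith),
    Real.logb_le_logb_of_le one_lt_two (by linarith) ?_⟩
  have hc : 0 ≤ β0 / H ^ 2 := by positivity
  have f1 := mul_le_mul_of_nonneg_left a1 hq1
  have f2 := mul_le_mul_of_nonneg_left b1 hq2
  have f3 := mul_le_mul_of_nonneg_right hq hc
  rw [mul_div_assoc]
  linarith

theorem intervalIntegrable_of_measurable_of_bounds {f : ℝ → ℝ} {T C : ℝ} (hf : Measurable f)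
    (hC : ∀ t, 0 ≤ f t ∧ f t ≤ C) : IntervalIntegrable f volume 0 T := by
  refine (intervalIntegrable_const (c := C)).mono_fun hf.aestronglyMeasurable ?_
  refine Filter.Eventually.of_forall fun t => ?_
  simp only [Real.norm_eq_abs]
  exact abs_le_abs_of_nonneg (hC t).1 (hC t).2

theorem mul_le_integral_of_eq_on_subinterval {f : ℝ → ℝ} {T C c d : ℝ} (hf : Measurable f)
    (hC : ∀ t, 0 ≤ f t ∧ f t ≤ C) (hc : 0 ≤ c) (hcd : c ≤ d) (hd : d ≤ T)
    (h : ∀ t ∈ Set.Ioc c d, f t = C) : (d - c) * C ≤ ∫ t in (0 : ℝ)..T, f t := by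
  have e : ∫ t in c..d, f t = (d - c) * C := by
    rw [intervalIntegral.integral_congr_ae (g := fun _ => C)]
    · simp
    · refine Filter.Eventually.of_forall fun t ht => h t ?_
      rwa [Set.uIoc_of_le hcd] at ht
  rw [← e]
  exact intervalIntegral.integral_mono_interval hc hcd hd
    (Filter.Eventually.of_forall fun t => (hC t).1)
    (intervalIntegrable_of_measurable_of_bounds hf hC)

/-- Hover above user 1 until time `a`, then fly at speed `V` to user 2 and hover there. -/
noncomputable def hoverFlyHover (D V a t : ℝ) : ℝ :=
  max (-(D / 2)) (min (D / 2) (V * (t - a) - D / 2))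

theorem feasibleTraj_hoverFlyHover (D T a : ℝ) {V : ℝ} (hV : 0 < V) :
    FeasibleTraj V T (hoverFlyHover D V a) := by
  intro s _ t _
  unfold hoverFlyHover
  have e : (V * (s - a) - D / 2) - (V * (t - a) - D / 2) = V * (s - t) := by ring
  calc _ ≤ max |-(D / 2) - -(D / 2)| |min (D / 2) (V * (s - a) - D / 2) -
          min (D / 2) (V * (t - a) - D / 2)| := abs_max_sub_max_le_max _ _ _ _
    _ ≤ |(V * (s - a) - D / 2) - (V * (t - a) - D / 2)| := by
        refine max_le (by simp) ?_
        refine (abs_min_sub_min_le_max _ _ _ _).trans (by simp)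
    _ = V * |s - t| := by rw [e, abs_mul, abs_of_pos hV]

theorem continuous_hoverFlyHover (D V a : ℝ) : Continuous (hoverFlyHover D V a) := by
  unfold hoverFlyHover
  fun_prop

theorem hoverFlyHover_of_le {D V a t : ℝ} (hV : 0 < V) (ht : t ≤ a) :
    hoverFlyHover D V a t = -(D / 2) := by
  have : V * (t - a) ≤ 0 := mul_nonpos_of_nonneg_of_nonpos hV.le (by linarith)
  unfold hoverFlyHover
  exact max_eq_left ((min_le_right _ _).trans (by linarith))

theorem hoverFlyHover_of_add_le {D V a t : ℝ} (hD : 0 < D) (hV : 0 < V) (ht : a + D / V ≤ t) :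
    hoverFlyHover D V a t = D / 2 := by
  have h : D ≤ V * (t - a) := by
    have : D / V ≤ t - a := by linarith
    rwa [div_le_iff₀' hV] at this
  unfold hoverFlyHover
  rw [min_eq_left (by linarith), max_eq_right (by linarith)]

/-- Time division along the hover-fly-hover trajectory, switching users at time `a`. -/
theorem mem_capacityRegion_of_tdma {D H β0 P V T a r1 r2 : ℝ} (hD : 0 < D) (hH : 0 < H)
    (hβ : 0 < β0) (hP : 0 < P) (hV : 0 < V) (hT : 0 < T) (ha : 0 ≤ a) (haT : a + D / V ≤ T)
    (hr1 : 0 ≤ r1) (hr2 : 0 ≤ r2) (h₁ : r1 * T ≤ a * Real.logb 2 (1 + P * β0 / H ^ 2))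
    (h₂ : r2 * T ≤ (T - (a + D / V)) * Real.logb 2 (1 + P * β0 / H ^ 2)) :
    (r1, r2) ∈ CapacityRegion D H β0 P V T := by
  have hDV : 0 < D / V := div_pos hD hV
  set C := Real.logb 2 (1 + P * β0 / H ^ 2) with hC
  let x := hoverFlyHover D V a
  let p1 : ℝ → ℝ := fun t => if t ≤ a then P else 0
  let p2 : ℝ → ℝ := fun t => if t ≤ a then 0 else P
  have hx : Measurable x := (continuous_hoverFlyHover D V a).measurable
  have mp1 : Measurable p1 := Measurable.ite measurableSet_Iic measurable_const measurable_const
  have mp2 : Measurable p2 := Measurable.ite measurableSet_Iic measurable_const measurable_const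
  have hp : ∀ t, 0 ≤ p1 t ∧ 0 ≤ p2 t ∧ p1 t + p2 t ≤ P := by
    intro t
    by_cases h : t ≤ a <;> simp [p1, p2, h, hP.le]
  let f1 : ℝ → ℝ := fun t => Real.logb 2 (1 + p1 t * h1 D H β0 (x t))
  let f2 : ℝ → ℝ := fun t => Real.logb 2 (1 + p2 t * h2 D H β0 (x t))
  have mf1 : Measurable f1 := by
    unfold f1 h1 Real.logb
    fun_prop
  have mf2 : Measurable f2 := by
    unfold f2 h2 Real.logb
    fun_prop
  have b1 : ∀ t, 0 ≤ f1 t ∧ f1 t ≤ C := by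
    intro t
    have := logb_sum_rate_bounds D β0 (x t) hH hβ (hp t).1 le_rfl
      (by linarith [(hp t).2.1, (hp t).2.2] : p1 t + 0 ≤ P)
    simpa [f1] using this
  have b2 : ∀ t, 0 ≤ f2 t ∧ f2 t ≤ C := by
    intro t
    have := logb_sum_rate_bounds D β0 (x t) hH hβ le_rfl (hp t).2.1
      (by linarith [(hp t).1, (hp t).2.2] : 0 + p2 t ≤ P)
    simpa [f2] using this
  have i1 : r1 * T ≤ ∫ t in (0 : ℝ)..T, f1 t := by
    have := mul_le_integral_of_eq_on_subinterval mf1 b1 le_rfl ha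
      (by linarith : a ≤ T) fun t ht => by
        simp [f1, p1, x, hoverFlyHover_of_le hV ht.2, ht.2, h1, hC, mul_div_assoc]
    linarith
  have i2 : r2 * T ≤ ∫ t in (0 : ℝ)..T, f2 t := by
    have := mul_le_integral_of_eq_on_subinterval mf2 b2 (by linarith : 0 ≤ a + D / V) haT
      le_rfl fun t ht => by
        have hta : ¬ t ≤ a := by linarith [ht.1]
        simp [f2, p2, x, hoverFlyHover_of_add_le hD hV ht.1.le, hta, h2, hC, mul_div_assoc]
    linarith
  have key : ∫ t in (0 : ℝ)..T, Real.logb 2 (1 + p1 t * h1 D H β0 (x t) + p2 t * h2 D H β0 (x t))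
      = (∫ t in (0 : ℝ)..T, f1 t) + ∫ t in (0 : ℝ)..T, f2 t := by
    rw [← intervalIntegral.integral_add (intervalIntegrable_of_measurable_of_bounds mf1 b1)
      (intervalIntegrable_of_measurable_of_bounds mf2 b2)]
    congr 1
    funext t
    by_cases h : t ≤ a <;> simp [f1, f2, p1, p2, h]
  refine ⟨x, p1, p2, feasibleTraj_hoverFlyHover D T a hV, ⟨mp1, mp2, fun t _ => hp t⟩,
    hr1, hr2, ?_, ?_, ?_⟩
  · rw [one_div, inv_mul_eq_div, le_div_iff₀ hT]
    exact i1
  · rw [one_div, inv_mul_eq_div, le_div_iff₀ hT]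
    exact i2
  · rw [one_div, inv_mul_eq_div, le_div_iff₀ hT, key]
    linarith

/-- For fixed `V > 0` and `C0 = log2(1 + P β0 / H²)`:
(i) for every `T > 0` the capacity region is contained in the triangle
`{r1 ≥ 0, r2 ≥ 0, r1 + r2 ≤ C0}`; (ii) every pair with `r1, r2 ≥ 0` and
`r1 + r2 < C0` belongs to `C(V, T, P)` for all sufficiently large `T`.
Hence `C(V, T, P)` converges to the triangle as `T → ∞`. -/
theorem capacity_region_large_duration (D H β0 P V : ℝ)
    (hD : 0 < D) (hH : 0 < H) (hβ : 0 < β0) (hP : 0 < P) (hV : 0 < V) :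
    (∀ T : ℝ, 0 < T →
      CapacityRegion D H β0 P V T ⊆
        {r : ℝ × ℝ | 0 ≤ r.1 ∧ 0 ≤ r.2 ∧
          r.1 + r.2 ≤ Real.logb 2 (1 + P * β0 / H ^ 2)}) ∧
    (∀ r1 r2 : ℝ, 0 ≤ r1 → 0 ≤ r2 →
      r1 + r2 < Real.logb 2 (1 + P * β0 / H ^ 2) →
      ∃ T0 : ℝ, 0 < T0 ∧ ∀ T : ℝ, T0 ≤ T →
        (r1, r2) ∈ CapacityRegion D H β0 P V T) := by
  refine ⟨?_, ?_⟩
  · rintro T hT r ⟨x, p1, p2, -, ⟨-, -, hp⟩, hr1, hr2, -, -, hr⟩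
    refine ⟨hr1, hr2, hr.trans ?_⟩
    rw [one_div, inv_mul_eq_div, div_le_iff₀ hT]
    have h := intervalIntegral.norm_integral_le_of_norm_le_const (a := 0) (b := T)
      (C := Real.logb 2 (1 + P * β0 / H ^ 2))
      (f := fun t => Real.logb 2 (1 + p1 t * h1 D H β0 (x t) + p2 t * h2 D H β0 (x t))) (by
        intro t ht
        rw [Set.uIoc_of_le hT.le] at ht
        obtain ⟨q1, q2, q⟩ := hp t ⟨ht.1.le, ht.2⟩
        obtain ⟨l, u⟩ := logb_sum_rate_bounds D β0 (x t) hH hβ q1 q2 q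
        rwa [Real.norm_eq_abs, abs_of_nonneg l])
    rw [sub_zero, abs_of_pos hT] at h
    exact (le_abs_self _).trans h
  · intro r1 r2 hr1 hr2 hr
    set C := Real.logb 2 (1 + P * β0 / H ^ 2) with hC
    have hC0 : 0 < C := by linarith
    have hg : 0 < C - r1 - r2 := by linarith
    have hDV : 0 < D / V := div_pos hD hV
    refine ⟨D / V * C / (C - r1 - r2), by positivity, fun T hT => ?_⟩
    have hT0 : 0 < T := lt_of_lt_of_le (by positivity) hT
    rw [div_le_iff₀ hg] at hT
    have e : r1 * T / C * C = r1 * T := div_mul_cancel₀ _ hC0.ne'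
    have h₂ : r2 * T ≤ (T - (r1 * T / C + D / V)) * C := by linarith
    refine mem_capacityRegion_of_tdma hD hH hβ hP hV hT0 (a := r1 * T / C) (by positivity) ?_
      hr1 hr2 e.ge h₂
    have : 0 ≤ T - (r1 * T / C + D / V) :=
      nonneg_of_mul_nonneg_left ((mul_nonneg hr2 hT0.le).trans h₂) hC0
    linarith
end

section
/- Let h1, h2 be real numbers with h1 ≥ h2 > 0 and let p1, p2 ≥ 0. Then log2(1 + p1·h1) + log2(1 + p2·h2/(p1·h2 + 1)) ≤ log2(1 + (p1 + p2)·h1). -/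
/-- Sum-rate inequality for superposition coding on a degraded
broadcast channel with gains `h1 ≥ h2 > 0` and powers `p1, p2 ≥ 0`:
`log2(1 + p1 h1) + log2(1 + p2 h2 / (p1 h2 + 1)) ≤ log2(1 + (p1 + p2) h1)`. -/
theorem sc_sum_rate_le (h1 h2 p1 p2 : ℝ)
    (hh : h2 ≤ h1) (hh2 : 0 < h2) (hp1 : 0 ≤ p1) (hp2 : 0 ≤ p2) :
    Real.logb 2 (1 + p1 * h1) + Real.logb 2 (1 + p2 * h2 / (p1 * h2 + 1)) ≤
      Real.logb 2 (1 + (p1 + p2) * h1) := by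
  have hh1 : 0 < h1 := hh2.trans_le hh
  have hx : 0 < 1 + p1 * h1 := by positivity
  have hd : 0 < p1 * h2 + 1 := by positivity
  have hy : 0 < 1 + p2 * h2 / (p1 * h2 + 1) := by positivity
  rw [← Real.logb_mul hx.ne' hy.ne']
  refine Real.logb_le_logb_of_le one_lt_two (mul_pos hx hy) ?_
  have key : (1 + p1 * h1) * (p2 * h2 / (p1 * h2 + 1)) ≤ p2 * h1 := by
    rw [← mul_div_assoc, div_le_iff₀ hd]
    linarith [mul_le_mul_of_nonneg_left hh hp2]
  linarith
end

section
/- Let h1 ≥ h2 > 0, P̄ > 0, and p1, p2 ≥ 0 with p1 + p2 = P̄. Set r1 = log2(1 + p1·h1), r2 = log2(1 + p2·h2/(p1·h2 + 1)), and R2 = log2(1 + P̄·h1). If r2 ≥ r1 and r1 < R2, then r1 + r2 ≤ R2 and, with β = (R2 − r2)/(R2 − r1), one has β ∈ [0,1], β·r2 ≥ r1, and β·r1 + (1−β)·R2 = r2; i.e., the convex combination β·(r2, r1) + (1−β)·(0, R2) dominates (r1, r2) componentwise. (This is the time-sharing construction showing that for a static UAV serving two users with rate priority on the second user, there always exists an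 optimal hovering location on the side of that user, i.e., in [0, D/2].) -/
/-- Time-sharing construction underlying Proposition 2. With
`h1 ≥ h2 > 0`, `p1 + p2 = P̄`, superposition-coding rates
`r1 = log2(1 + p1 h1)`, `r2 = log2(1 + p2 h2 / (p1 h2 + 1))`, and
`R2 = log2(1 + P̄ h1)`: if `r2 ≥ r1` and `r1 < R2`, then `r1 + r2 ≤ R2`, and
with `β = (R2 - r2) / (R2 - r1)` one has `β ∈ [0, 1]`, `β r2 ≥ r1`, and
`β r1 + (1 - β) R2 = r2`; i.e. `β (r2, r1) + (1 - β)(0, R2)` dominates `(r1, r2)`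
componentwise. -/
theorem time_sharing_dominates (h1 h2 P p1 p2 : ℝ)
    (hh : h2 ≤ h1) (hh2 : 0 < h2) (hP : 0 < P)
    (hp1 : 0 ≤ p1) (hp2 : 0 ≤ p2) (hsum : p1 + p2 = P)
    (r1 r2 R2 : ℝ)
    (hr1 : r1 = Real.logb 2 (1 + p1 * h1))
    (hr2 : r2 = Real.logb 2 (1 + p2 * h2 / (p1 * h2 + 1)))
    (hR2 : R2 = Real.logb 2 (1 + P * h1))
    (hord : r1 ≤ r2) (hlt : r1 < R2) :
    r1 + r2 ≤ R2 ∧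
    0 ≤ (R2 - r2) / (R2 - r1) ∧ (R2 - r2) / (R2 - r1) ≤ 1 ∧
    r1 ≤ ((R2 - r2) / (R2 - r1)) * r2 ∧
    ((R2 - r2) / (R2 - r1)) * r1 + (1 - (R2 - r2) / (R2 - r1)) * R2 = r2 := by
  subst hsum
  have hh1 : 0 < h1 := hh2.trans_le hh
  have hden : 0 < p1 * h2 + 1 := by positivity
  have hr1_nonneg : 0 ≤ r1 := by
    rw [hr1]
    exact Real.logb_nonneg one_lt_two (by nlinarith [mul_nonneg hp1 hh1.le])
  have hrate : r1 + r2 ≤ R2 := by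
    rw [hr1, hr2, hR2, ← Real.logb_mul (by positivity) (by positivity)]
    refine Real.logb_le_logb_of_le one_lt_two (by positivity) ?_
    have hsnr : (1 + p1 * h1) * (p2 * h2 / (p1 * h2 + 1)) ≤ p2 * h1 := by
      rw [← mul_div_assoc, div_le_iff₀ hden]
      nlinarith [mul_le_mul_of_nonneg_left hh hp2]
    linarith
  have hgap : 0 < R2 - r1 := sub_pos.mpr hlt
  refine ⟨hrate, div_nonneg (by linarith) hgap.le, ?_, ?_, ?_⟩
  · rw [div_le_one hgap]
    linarith
  · rw [div_mul_eq_mul_div, le_div_iff₀ hgap]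
    nlinarith [mul_nonneg (sub_nonneg.mpr hord) (sub_nonneg.mpr hrate)]
  · field_simp
    ring
end

section
/- (Uplink–downlink duality instance.) Let h1 ≥ h2 > 0, P̄ > 0, and p1, p2 ≥ 0 with p1 + p2 ≤ P̄. Set r1 = log2(1 + p1·h1) and r2 = log2(1 + p2·h2/(p1·h2 + 1)). Then there exist q1, q2 ≥ 0 with q1 + q2 ≤ P̄ such that r1 ≤ log2(1 + q1·h1), r2 ≤ log2(1 + q2·h2), and r1 + r2 ≤ log2(1 + q1·h1 + q2·h2). That is, every superposition-coding broadcast rate pair with total power P̄ lies in the union over power splits of the dual two-user multiple-access-channel regions with the same total power. -/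
/-- Uplink–downlink duality instance: every superposition-coding
broadcast rate pair with gains `h1 ≥ h2 > 0` and total power at most `P̄` lies in
the dual two-user multiple-access-channel region for some power split `(q1, q2)`
with `q1 + q2 ≤ P̄`. -/
theorem sc_pair_in_dual_mac (h1 h2 P p1 p2 : ℝ)
    (hh : h2 ≤ h1) (hh2 : 0 < h2) (hP : 0 < P)
    (hp1 : 0 ≤ p1) (hp2 : 0 ≤ p2) (hsum : p1 + p2 ≤ P) :
    ∃ q1 q2 : ℝ, 0 ≤ q1 ∧ 0 ≤ q2 ∧ q1 + q2 ≤ P ∧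
      Real.logb 2 (1 + p1 * h1) ≤ Real.logb 2 (1 + q1 * h1) ∧
      Real.logb 2 (1 + p2 * h2 / (p1 * h2 + 1)) ≤ Real.logb 2 (1 + q2 * h2) ∧
      Real.logb 2 (1 + p1 * h1) + Real.logb 2 (1 + p2 * h2 / (p1 * h2 + 1)) ≤
        Real.logb 2 (1 + q1 * h1 + q2 * h2) := by
  have hh1 : 0 < h1 := hh2.trans_le hh
  have hd : 0 < p1 * h2 + 1 := by positivity
  obtain ⟨q, hq, rfl⟩ : ∃ q, 0 ≤ q ∧ p2 = q * (p1 * h2 + 1) :=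
    ⟨p2 / (p1 * h2 + 1), by positivity, by field_simp⟩
  have hr : q * (p1 * h2 + 1) * h2 / (p1 * h2 + 1) = q * h2 := by field_simp
  rw [hr]
  refine ⟨p1 * (1 + q * h2), q, by positivity, hq, by linarith, ?_, le_rfl, ?_⟩
  · refine Real.logb_le_logb_of_le one_lt_two (by positivity) ?_
    have : 0 ≤ p1 * (q * h2) * h1 := by positivity
    linarith
  · rw [← Real.logb_mul (by positivity) (by positivity)]
    exact le_of_eq (by ring_nf)
end
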